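/- In the McKean–Vlasov setting of Lemma 7.4 — B : [0,T] × ℝ^d × P₁ → ℝ^d continuous in s for fixed (x,ν), satisfying ‖B(s,x,ν) − B(s,x',ν')‖ ≤ L(‖x−x'‖ + ∫‖y−y'‖dπ) for every coupling π of ν and ν', and ‖B(s,x,ν)‖ ≤ L̄(1+‖x‖+‖ν‖₁) — let 0 ≤ t ≤ t' ≤ s ≤ T, m ∈ P₁, and let X^{t,m}, X^{t',m} be the unique jointly continuous linear-growth solutions with initial measure m and initial times t and t'. Then ‖X^{t',m}_s(x) − X^{t,m}_s(x)‖ ≤ (t'−t) · L̄ · e^{L(s−t')} · ( 1 + sup_{τ∈[t,t']} ‖X^{t,m}_τ(x)‖ + sup_{τ∈[t,t']} ∫‖X^{t,m}_τ(y)‖dm(y) + L(s−t') (1 + 2 sup_{τ∈[t,t']} ∫‖X^{t,m}_τ(y)‖dm(y)) e^{2L(s−t')} ). -/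

import Mathlib

open MeasureTheory Set

/-- Probability measures on `ℝ^d` with finite first moment. -/
def MemP1 {d : ℕ} (μ : Measure (EuclideanSpace ℝ (Fin d))) : Prop :=
  IsProbabilityMeasure μ ∧ Integrable (fun x => ‖x‖) μ

/-- `π` is a coupling of `μ` and `ν`. -/
def IsCoupling {d : ℕ} (π : Measure (EuclideanSpace ℝ (Fin d) × EuclideanSpace ℝ (Fin d)))
    (μ ν : Measure (EuclideanSpace ℝ (Fin d))) : Prop :=
  IsProbabilityMeasure π ∧ π.map Prod.fst = μ ∧ π.map Prod.snd = ν

/-- The first moment `‖ν‖₁ = ∫ ‖y‖ dν(y)`. -/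
noncomputable def mnorm1 {d : ℕ} (ν : Measure (EuclideanSpace ℝ (Fin d))) : ℝ :=
  ∫ y, ‖y‖ ∂ν

open intervalIntegral in
/-- Grönwall's inequality in integral form. -/
theorem ContinuousOn.le_mul_exp_of_le_add_integral {u : ℝ → ℝ} {a b c K : ℝ} (hK : 0 ≤ K)
    (hu : ContinuousOn u (Icc a b))
    (h : ∀ σ ∈ Icc a b, u σ ≤ c + K * ∫ τ in a..σ, u τ) :
    ∀ σ ∈ Icc a b, u σ ≤ c * Real.exp (K * (σ - a)) := by
  intro σ hσ
  have hab : a ≤ b := hσ.1.trans hσ.2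
  set F : ℝ → ℝ := fun σ => ∫ τ in a..σ, u τ with hF
  set G : ℝ → ℝ := fun σ => (c + K * F σ) * Real.exp (-(K * (σ - a))) with hG
  have hui : IntervalIntegrable u volume a b := hu.intervalIntegrable_of_Icc hab
  have hFc : ContinuousOn F (Icc a b) := by
    have := continuousOn_primitive_interval' hui left_mem_uIcc
    rwa [uIcc_of_le hab] at this
  have hGc : ContinuousOn G (Icc a b) := by
    have h1 : Continuous fun σ : ℝ => Real.exp (-(K * (σ - a))) := by fun_prop
    exact (continuousOn_const.add (continuousOn_const.mul hFc)).mul h1.continuousOn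
  have hFd : ∀ x ∈ Ioo a b, HasDerivAt F (u x) x := by
    intro x hx
    have hnhds : Icc a b ∈ nhds x := Icc_mem_nhds hx.1 hx.2
    refine integral_hasDerivAt_right ?_ ?_ (hu.continuousAt hnhds)
    · exact (hu.mono (Icc_subset_Icc le_rfl hx.2.le)).intervalIntegrable_of_Icc hx.1.le
    · exact ⟨Icc a b, hnhds, hu.aestronglyMeasurable measurableSet_Icc⟩
  have hGd : ∀ x ∈ Ioo a b, HasDerivAt G
      (K * u x * Real.exp (-(K * (x - a))) +
        (c + K * F x) * (Real.exp (-(K * (x - a))) * (-(K * 1)))) x := by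
    intro x hx
    exact (((hFd x hx).const_mul K).const_add c).mul
      ((((hasDerivAt_id x).sub_const a).const_mul K).neg.exp)
  have hanti : AntitoneOn G (Icc a b) := by
    refine antitoneOn_of_deriv_nonpos (convex_Icc a b) hGc ?_ ?_
    · rw [interior_Icc]
      exact fun x hx => (hGd x hx).differentiableAt.differentiableWithinAt
    · rw [interior_Icc]
      intro x hx
      rw [(hGd x hx).deriv]
      have h1 := h x (Ioo_subset_Icc_self hx)
      have h2 : 0 ≤ K * Real.exp (-(K * (x - a))) := by positivity
      nlinarith [mul_le_mul_of_nonneg_left h1 h2]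
  have h0 : G σ ≤ c := by
    have := hanti (left_mem_Icc.2 hab) hσ hσ.1
    simpa [hG, hF] using this
  have hexp : Real.exp (-(K * (σ - a))) * Real.exp (K * (σ - a)) = 1 := by
    rw [← Real.exp_add]; simp
  calc u σ ≤ c + K * F σ := h σ hσ
    _ = G σ * Real.exp (K * (σ - a)) := by rw [hG]; linear_combination -(c + K * F σ) * hexp
    _ ≤ c * Real.exp (K * (σ - a)) := by gcongr

section Parametric

variable {E : Type*} [NormedAddCommGroup E]

theorem ContinuousOn.slice_right {F : Type*} [TopologicalSpace F] {f : ℝ → E → F} {S : Set ℝ}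
    (hf : ContinuousOn (fun q : ℝ × E => f q.1 q.2) (S ×ˢ univ)) {τ : ℝ} (hτ : τ ∈ S) :
    Continuous (f τ) := by
  rw [← continuousOn_univ]
  exact hf.comp (f := fun y => (τ, y)) (by fun_prop) fun y _ => ⟨hτ, mem_univ _⟩

theorem ContinuousOn.slice_left {F : Type*} [TopologicalSpace F] {f : ℝ → E → F} {S : Set ℝ}
    (hf : ContinuousOn (fun q : ℝ × E => f q.1 q.2) (S ×ˢ univ)) (y : E) :
    ContinuousOn (fun τ => f τ y) S :=
  hf.comp (f := fun τ => (τ, y)) (by fun_prop) fun _ hτ => ⟨hτ, mem_univ _⟩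

variable [MeasurableSpace E] [BorelSpace E] {m : Measure E} {a b : ℝ}

theorem ContinuousOn.integral_of_dominated {f : ℝ → E → ℝ} {g : E → ℝ}
    {S : Set ℝ} (hf : ContinuousOn (fun q : ℝ × E => f q.1 q.2) (S ×ˢ univ))
    (hg : Integrable g m) (hfg : ∀ τ ∈ S, ∀ y, ‖f τ y‖ ≤ g y) :
    ContinuousOn (fun τ => ∫ y, f τ y ∂m) S :=
  continuousOn_of_dominated (fun _ hτ => (hf.slice_right hτ).aestronglyMeasurable)
    (fun τ hτ => .of_forall (hfg τ hτ)) hg (.of_forall hf.slice_left)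

variable [SecondCountableTopology E]

theorem ContinuousOn.integrable_prod_of_dominated [IsFiniteMeasure m] {f : ℝ → E → ℝ} {g : E → ℝ}
    (hf : ContinuousOn (fun q : ℝ × E => f q.1 q.2) (Icc a b ×ˢ univ))
    (hg : Integrable g m) (hfg : ∀ τ ∈ Icc a b, ∀ y, ‖f τ y‖ ≤ g y) :
    Integrable (fun q : ℝ × E => f q.1 q.2) ((volume.restrict (Ioc a b)).prod m) := by
  have hr : (volume.restrict (Ioc a b)).prod m = (volume.prod m).restrict (Ioc a b ×ˢ univ) := by
    rw [← Measure.prod_restrict, Measure.restrict_univ]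
  have hmeas : MeasurableSet (Ioc a b ×ˢ (univ : Set E)) := measurableSet_Ioc.prod .univ
  have hg' : Integrable (fun q : ℝ × E => g q.2) ((volume.restrict (Ioc a b)).prod m) :=
    hg.comp_snd _
  refine hg'.mono' ?_ ?_
  · rw [hr]
    exact (hf.mono (prod_mono Ioc_subset_Icc_self le_rfl)).aestronglyMeasurable hmeas
  · rw [hr]
    filter_upwards [ae_restrict_mem hmeas] with q hq
    exact hfg q.1 (Ioc_subset_Icc_self hq.1) q.2

theorem ContinuousOn.integrable_intervalIntegral [IsFiniteMeasure m] {f : ℝ → E → ℝ} {g : E → ℝ}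
    (hab : a ≤ b) (hf : ContinuousOn (fun q : ℝ × E => f q.1 q.2) (Icc a b ×ˢ univ))
    (hg : Integrable g m) (hfg : ∀ τ ∈ Icc a b, ∀ y, ‖f τ y‖ ≤ g y) :
    Integrable (fun y => ∫ τ in a..b, f τ y) m := by
  simp only [intervalIntegral.integral_of_le hab]
  exact (hf.integrable_prod_of_dominated hg hfg).integral_prod_right

theorem ContinuousOn.integral_intervalIntegral_swap [IsFiniteMeasure m] {f : ℝ → E → ℝ}
    {g : E → ℝ} (hab : a ≤ b) (hf : ContinuousOn (fun q : ℝ × E => f q.1 q.2) (Icc a b ×ˢ univ))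
    (hg : Integrable g m) (hfg : ∀ τ ∈ Icc a b, ∀ y, ‖f τ y‖ ≤ g y) :
    ∫ y, (∫ τ in a..b, f τ y) ∂m = ∫ τ in a..b, ∫ y, f τ y ∂m := by
  simp only [intervalIntegral.integral_of_le hab]
  exact (integral_integral_swap (hf.integrable_prod_of_dominated hg hfg)).symm

end Parametric

section McKeanVlasov

variable {d : ℕ} {m : Measure (EuclideanSpace ℝ (Fin d))}
  {f g : EuclideanSpace ℝ (Fin d) → EuclideanSpace ℝ (Fin d)}

theorem MemP1.map (hm : MemP1 m) (hf : Continuous f) (hfi : Integrable (fun y => ‖f y‖) m) :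
    MemP1 (m.map f) := by
  have := hm.1
  refine ⟨Measure.isProbabilityMeasure_map hf.aemeasurable, ?_⟩
  exact (integrable_map_measure continuous_norm.aestronglyMeasurable hf.aemeasurable).2 hfi

theorem mnorm1_map (hf : Continuous f) : mnorm1 (m.map f) = ∫ y, ‖f y‖ ∂m :=
  integral_map hf.aemeasurable continuous_norm.aestronglyMeasurable

theorem MemP1.isCoupling_map (hm : MemP1 m) (hf : Continuous f) (hg : Continuous g) :
    IsCoupling (m.map fun y => (f y, g y)) (m.map f) (m.map g) := by
  have := hm.1
  have hfg : Measurable fun y => (f y, g y) := (hf.prodMk hg).measurable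
  refine ⟨Measure.isProbabilityMeasure_map hfg.aemeasurable, ?_, ?_⟩
  · rw [Measure.map_map measurable_fst hfg]; rfl
  · rw [Measure.map_map measurable_snd hfg]; rfl

variable {L : ℝ} {B : ℝ → EuclideanSpace ℝ (Fin d) → Measure (EuclideanSpace ℝ (Fin d)) →
      EuclideanSpace ℝ (Fin d)}

theorem norm_sub_le_of_map (hm : MemP1 m)
    (hBlip : ∀ s x x' ν ν' π, MemP1 ν → MemP1 ν' → IsCoupling π ν ν' →
      ‖B s x ν - B s x' ν'‖ ≤ L * (‖x - x'‖ + ∫ q, ‖q.1 - q.2‖ ∂π))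
    (hf : Continuous f) (hg : Continuous g) (hfi : Integrable (fun y => ‖f y‖) m)
    (hgi : Integrable (fun y => ‖g y‖) m) (s : ℝ) (x x' : EuclideanSpace ℝ (Fin d)) :
    ‖B s x (m.map f) - B s x' (m.map g)‖ ≤ L * (‖x - x'‖ + ∫ y, ‖f y - g y‖ ∂m) := by
  have h := hBlip s x x' _ _ _ (hm.map hf hfi) (hm.map hg hgi) (hm.isCoupling_map hf hg)
  rwa [integral_map (hf.prodMk hg).aemeasurable
    (by fun_prop : Continuous fun q : EuclideanSpace ℝ (Fin d) × EuclideanSpace ℝ (Fin d) =>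
      ‖q.1 - q.2‖).aestronglyMeasurable] at h

/-- The drift is continuous in time along a jointly continuous flow dominated by an integrable
function. -/
theorem continuousOn_drift (hm : MemP1 m) {S : Set ℝ}
    (hBcont : ∀ x ν, MemP1 ν → ContinuousOn (fun s => B s x ν) S)
    (hBlip : ∀ s x x' ν ν' π, MemP1 ν → MemP1 ν' → IsCoupling π ν ν' →
      ‖B s x ν - B s x' ν'‖ ≤ L * (‖x - x'‖ + ∫ q, ‖q.1 - q.2‖ ∂π))
    {X : ℝ → EuclideanSpace ℝ (Fin d) → EuclideanSpace ℝ (Fin d)}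
    {G : EuclideanSpace ℝ (Fin d) → ℝ}
    (hX : ContinuousOn (fun q : ℝ × EuclideanSpace ℝ (Fin d) => X q.1 q.2) (S ×ˢ univ))
    (hG : Integrable G m) (hXG : ∀ τ ∈ S, ∀ y, ‖X τ y‖ ≤ G y) (x : EuclideanSpace ℝ (Fin d)) :
    ContinuousOn (fun τ => B τ (X τ x) (m.map (X τ))) S := by
  have hi : ∀ τ ∈ S, Integrable (fun y => ‖X τ y‖) m := fun τ hτ =>
    hG.mono' (hX.slice_right hτ).norm.aestronglyMeasurable (.of_forall fun y => by
      simpa using hXG τ hτ y)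
  intro τ₀ h₀
  have hc₀ := hX.slice_right h₀
  have hD : ContinuousOn (fun τ => ∫ y, ‖X τ y - X τ₀ y‖ ∂m) S := by
    refine ContinuousOn.integral_of_dominated (f := fun τ y => ‖X τ y - X τ₀ y‖)
      (g := fun y => G y + G y)
      (hX.sub (hc₀.comp continuous_snd).continuousOn).norm (hG.add hG) fun τ hτ y => ?_
    rw [norm_norm]
    exact (norm_sub_le _ _).trans (add_le_add (hXG τ hτ y) (hXG τ₀ h₀ y))
  have hh : ContinuousOn (fun τ => L * (‖X τ x - X τ₀ x‖ + ∫ y, ‖X τ y - X τ₀ y‖ ∂m) +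
      ‖B τ (X τ₀ x) (m.map (X τ₀)) - B τ₀ (X τ₀ x) (m.map (X τ₀))‖) S :=
    (continuousOn_const.mul (((hX.slice_left x).sub continuousOn_const).norm.add hD)).add
      ((hBcont _ _ (hm.map hc₀ (hi τ₀ h₀))).sub continuousOn_const).norm
  have hlim := hh τ₀ h₀
  rw [ContinuousWithinAt] at hlim ⊢
  simp only [sub_self, norm_zero, integral_zero, add_zero, mul_zero] at hlim
  rw [tendsto_iff_norm_sub_tendsto_zero]
  refine squeeze_zero' (.of_forall fun _ => norm_nonneg _) ?_ hlim
  filter_upwards [self_mem_nhdsWithin] with τ hτ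
  refine (norm_sub_le_norm_sub_add_norm_sub _ (B τ (X τ₀ x) (m.map (X τ₀))) _).trans ?_
  gcongr
  exact norm_sub_le_of_map hm hBlip (hX.slice_right hτ) hc₀ (hi τ hτ) (hi τ₀ h₀) τ _ _

end McKeanVlasov

/-- estimate (7.11) of Lemma 7.4: Lipschitz continuity of the McKean–Vlasov
flow in the initial time. -/
theorem stmt_13 (d : ℕ) (hd : 1 ≤ d) (T L Lb : ℝ) (hT : 0 < T) (hL : 0 < L) (hLb : 0 < Lb)
    (B : ℝ → EuclideanSpace ℝ (Fin d) → Measure (EuclideanSpace ℝ (Fin d)) →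
      EuclideanSpace ℝ (Fin d))
    (hBcont : ∀ x ν, MemP1 ν → ContinuousOn (fun s => B s x ν) (Icc 0 T))
    (hBlip : ∀ s x x' ν ν' π, MemP1 ν → MemP1 ν' → IsCoupling π ν ν' →
      ‖B s x ν - B s x' ν'‖ ≤ L * (‖x - x'‖ + ∫ q, ‖q.1 - q.2‖ ∂π))
    (hBgrow : ∀ s x ν, MemP1 ν → ‖B s x ν‖ ≤ Lb * (1 + ‖x‖ + mnorm1 ν))
    (t t' s : ℝ) (htt' : t ≤ t') (ht's : t' ≤ s) (hsT : s ≤ T) (ht : 0 ≤ t)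
    (m : Measure (EuclideanSpace ℝ (Fin d))) (hm : MemP1 m)
    -- `X` is the unique jointly continuous linear-growth solution with data `(t, m)`
    (X : ℝ → EuclideanSpace ℝ (Fin d) → EuclideanSpace ℝ (Fin d))
    (hXcont : ContinuousOn (fun q : ℝ × EuclideanSpace ℝ (Fin d) => X q.1 q.2)
      (Icc t T ×ˢ (univ : Set (EuclideanSpace ℝ (Fin d)))))
    (hXgrow : ∃ K : ℝ, ∀ σ ∈ Icc t T, ∀ x, ‖X σ x‖ ≤ K * (1 + ‖x‖ + mnorm1 m))
    (hXeq : ∀ σ ∈ Icc t T, ∀ x,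
      X σ x = x + ∫ τ in t..σ, B τ (X τ x) (Measure.map (X τ) m))
    -- `X'` is the unique jointly continuous linear-growth solution with data `(t', m)`
    (X' : ℝ → EuclideanSpace ℝ (Fin d) → EuclideanSpace ℝ (Fin d))
    (hX'cont : ContinuousOn (fun q : ℝ × EuclideanSpace ℝ (Fin d) => X' q.1 q.2)
      (Icc t' T ×ˢ (univ : Set (EuclideanSpace ℝ (Fin d)))))
    (hX'grow : ∃ K : ℝ, ∀ σ ∈ Icc t' T, ∀ x, ‖X' σ x‖ ≤ K * (1 + ‖x‖ + mnorm1 m))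
    (hX'eq : ∀ σ ∈ Icc t' T, ∀ x,
      X' σ x = x + ∫ τ in t'..σ, B τ (X' τ x) (Measure.map (X' τ) m)) :
    ∀ x : EuclideanSpace ℝ (Fin d),
      ‖X' s x - X s x‖ ≤
        (t' - t) * Lb * Real.exp (L * (s - t')) *
          (1 + sSup ((fun τ => ‖X τ x‖) '' Icc t t') +
            sSup ((fun τ => ∫ y, ‖X τ y‖ ∂m) '' Icc t t') +
            L * (s - t') * (1 + 2 * sSup ((fun τ => ∫ y, ‖X τ y‖ ∂m) '' Icc t t')) *
              Real.exp (2 * L * (s - t'))) := by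
  have := hm.1
  obtain ⟨K, hK⟩ := hXgrow
  obtain ⟨K', hK'⟩ := hX'grow
  have hsub : Icc t' T ⊆ Icc t T := Icc_subset_Icc htt' le_rfl
  have hsub₁ : Icc t t' ⊆ Icc t T := Icc_subset_Icc le_rfl (ht's.trans hsT)
  set G : EuclideanSpace ℝ (Fin d) → ℝ := fun y => K * (1 + ‖y‖ + mnorm1 m)
  set G' : EuclideanSpace ℝ (Fin d) → ℝ := fun y => K' * (1 + ‖y‖ + mnorm1 m)
  have hbase : Integrable (fun y : EuclideanSpace ℝ (Fin d) => 1 + ‖y‖ + mnorm1 m) m :=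
    ((integrable_const _).add hm.2).add (integrable_const _)
  have hG : Integrable G m := hbase.const_mul K
  have hG' : Integrable G' m := hbase.const_mul K'
  have hXi : ∀ τ ∈ Icc t T, Integrable (fun y => ‖X τ y‖) m := fun τ hτ =>
    hG.mono' (hXcont.slice_right hτ).norm.aestronglyMeasurable (.of_forall fun y => by
      simpa using hK τ hτ y)
  have hX'i : ∀ τ ∈ Icc t' T, Integrable (fun y => ‖X' τ y‖) m := fun τ hτ =>
    hG'.mono' (hX'cont.slice_right hτ).norm.aestronglyMeasurable (.of_forall fun y => by
      simpa using hK' τ hτ y)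
  have hb : ∀ x, ContinuousOn (fun τ => B τ (X τ x) (m.map (X τ))) (Icc t T) :=
    continuousOn_drift hm
      (fun x ν hν => (hBcont x ν hν).mono (Icc_subset_Icc ht le_rfl)) hBlip hXcont hG hK
  have hb' : ∀ x, ContinuousOn (fun τ => B τ (X' τ x) (m.map (X' τ))) (Icc t' T) :=
    continuousOn_drift hm
      (fun x ν hν => (hBcont x ν hν).mono (Icc_subset_Icc (ht.trans htt') le_rfl)) hBlip
      hX'cont hG' hK'
  set M : ℝ := sSup ((fun τ => ∫ y, ‖X τ y‖ ∂m) '' Icc t t')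
  have hMcont : ContinuousOn (fun τ => ∫ y, ‖X τ y‖ ∂m) (Icc t T) :=
    ContinuousOn.integral_of_dominated (f := fun τ y => ‖X τ y‖) hXcont.norm hG
      fun τ hτ y => by simpa using hK τ hτ y
  have hM : ∀ τ ∈ Icc t t', ∫ y, ‖X τ y‖ ∂m ≤ M := fun τ hτ =>
    le_csSup (isCompact_Icc.image_of_continuousOn (hMcont.mono hsub₁)).bddAbove
      (mem_image_of_mem _ hτ)
  have hM0 : 0 ≤ M :=
    (integral_nonneg fun y => norm_nonneg _).trans (hM t (left_mem_Icc.2 htt'))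
  have hA : ∀ x, ∀ τ ∈ Icc t t', ‖X τ x‖ ≤ sSup ((fun τ => ‖X τ x‖) '' Icc t t') :=
    fun x τ hτ => le_csSup (isCompact_Icc.image_of_continuousOn
      ((hXcont.slice_left x).norm.mono hsub₁)).bddAbove (mem_image_of_mem _ hτ)
  have hgrow : ∀ x, ∀ τ ∈ Icc t t',
      ‖B τ (X τ x) (m.map (X τ))‖ ≤ Lb * (1 + ‖X τ x‖ + M) := by
    intro x τ hτ
    have hc := hXcont.slice_right (hsub₁ hτ)
    refine (hBgrow τ (X τ x) _ (hm.map hc (hXi τ (hsub₁ hτ)))).trans ?_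
    rw [mnorm1_map hc]
    gcongr
    exact hM τ hτ
  set u : ℝ → EuclideanSpace ℝ (Fin d) → ℝ := fun τ y => ‖X' τ y - X τ y‖ with hu
  set D : ℝ → ℝ := fun τ => ∫ y, u τ y ∂m with hDdef
  have hucont : ContinuousOn (fun q : ℝ × EuclideanSpace ℝ (Fin d) => u q.1 q.2)
      (Icc t' T ×ˢ univ) :=
    (hX'cont.sub (hXcont.mono (prod_mono hsub le_rfl))).norm
  have hubound : ∀ τ ∈ Icc t' T, ∀ y, ‖u τ y‖ ≤ G' y + G y := by
    intro τ hτ y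
    rw [hu, norm_norm]
    exact (norm_sub_le _ _).trans (add_le_add (hK' τ hτ y) (hK τ (hsub hτ) y))
  have hDcont : ContinuousOn D (Icc t' T) :=
    hucont.integral_of_dominated (hG'.add hG) hubound
  have hlip : ∀ x, ∀ τ ∈ Icc t' T,
      ‖B τ (X' τ x) (m.map (X' τ)) - B τ (X τ x) (m.map (X τ))‖ ≤ L * (u τ x + D τ) :=
    fun x τ hτ => norm_sub_le_of_map hm hBlip (hX'cont.slice_right hτ)
      (hXcont.slice_right (hsub hτ)) (hX'i τ hτ) (hXi τ (hsub hτ)) τ _ _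
  have hmain : ∀ x, ∀ σ ∈ Icc t' T, u σ x ≤ ‖∫ τ in t..t', B τ (X τ x) (m.map (X τ))‖ +
      ((L * ∫ τ in t'..σ, u τ x) + L * ∫ τ in t'..σ, D τ) := by
    intro x σ hσ
    have hσs : Icc t' σ ⊆ Icc t' T := Icc_subset_Icc le_rfl hσ.2
    have i1 : IntervalIntegrable (fun τ => B τ (X τ x) (m.map (X τ))) volume t t' :=
      ((hb x).mono hsub₁).intervalIntegrable_of_Icc htt'
    have i2 : IntervalIntegrable (fun τ => B τ (X τ x) (m.map (X τ))) volume t' σ :=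
      ((hb x).mono (hσs.trans hsub)).intervalIntegrable_of_Icc hσ.1
    have i3 : IntervalIntegrable (fun τ => B τ (X' τ x) (m.map (X' τ))) volume t' σ :=
      ((hb' x).mono hσs).intervalIntegrable_of_Icc hσ.1
    have i4 : IntervalIntegrable (fun τ => u τ x) volume t' σ :=
      ((hucont.slice_left x).mono hσs).intervalIntegrable_of_Icc hσ.1
    have i5 : IntervalIntegrable D volume t' σ :=
      (hDcont.mono hσs).intervalIntegrable_of_Icc hσ.1
    have heq : X' σ x - X σ x = -(∫ τ in t..t', B τ (X τ x) (m.map (X τ))) +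
        ∫ τ in t'..σ, (B τ (X' τ x) (m.map (X' τ)) - B τ (X τ x) (m.map (X τ))) := by
      rw [hX'eq σ hσ x, hXeq σ (hsub hσ) x, intervalIntegral.integral_sub i3 i2,
        ← intervalIntegral.integral_add_adjacent_intervals i1 i2]
      abel
    have hle : ‖∫ τ in t'..σ, (B τ (X' τ x) (m.map (X' τ)) - B τ (X τ x) (m.map (X τ)))‖ ≤
        ∫ τ in t'..σ, L * (u τ x + D τ) :=
      intervalIntegral.norm_integral_le_of_norm_le hσ.1
        (.of_forall fun τ hτ => hlip x τ (hσs (Ioc_subset_Icc_self hτ))) ((i4.add i5).const_mul L)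
    rw [intervalIntegral.integral_const_mul, intervalIntegral.integral_add i4 i5, mul_add] at hle
    calc u σ x = ‖X' σ x - X σ x‖ := rfl
      _ ≤ _ := by
        rw [heq]
        refine (norm_add_le _ _).trans ?_
        rw [norm_neg]
        gcongr
  have hXn : ContinuousOn (fun q : ℝ × EuclideanSpace ℝ (Fin d) => Lb * (1 + ‖X q.1 q.2‖ + M))
      (Icc t t' ×ˢ univ) :=
    continuousOn_const.mul ((continuousOn_const.add
      (hXcont.mono (prod_mono hsub₁ le_rfl)).norm).add continuousOn_const)
  have hXnbound : ∀ τ ∈ Icc t t', ∀ y, ‖Lb * (1 + ‖X τ y‖ + M)‖ ≤ Lb * (1 + G y + M) := by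
    intro τ hτ y
    rw [Real.norm_of_nonneg (by positivity)]
    gcongr
    exact hK τ (hsub₁ hτ) y
  have hGi : Integrable (fun y => Lb * (1 + G y + M)) m :=
    (((integrable_const _).add hG).add (integrable_const _)).const_mul Lb
  have hinit : ∀ y, ‖∫ τ in t..t', B τ (X τ y) (m.map (X τ))‖ ≤
      ∫ τ in t..t', Lb * (1 + ‖X τ y‖ + M) := fun y =>
    intervalIntegral.norm_integral_le_of_norm_le htt'
      (.of_forall fun τ hτ => hgrow y τ (Ioc_subset_Icc_self hτ))
      ((hXn.slice_left (f := fun τ y => Lb * (1 + ‖X τ y‖ + M)) y).intervalIntegrable_of_Icc htt')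
  have hinitm : ∫ y, (∫ τ in t..t', Lb * (1 + ‖X τ y‖ + M)) ∂m ≤ (t' - t) * Lb * (1 + 2 * M) := by
    rw [ContinuousOn.integral_intervalIntegral_swap (f := fun τ y => Lb * (1 + ‖X τ y‖ + M))
      htt' hXn hGi hXnbound]
    calc _ ≤ ∫ τ in t..t', Lb * (1 + 2 * M) := by
          refine intervalIntegral.integral_mono_on htt' ?_ intervalIntegrable_const fun τ hτ => ?_
          · exact (hXn.integral_of_dominated (f := fun τ y => Lb * (1 + ‖X τ y‖ + M))
              hGi hXnbound).intervalIntegrable_of_Icc htt'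
          · have hi := hXi τ (hsub₁ hτ)
            have hi₁ : Integrable (fun y => 1 + ‖X τ y‖) m := (integrable_const _).add hi
            rw [integral_const_mul, integral_add hi₁ (integrable_const _),
              integral_add (integrable_const _) hi]
            simp only [integral_const, probReal_univ, one_smul]
            exact mul_le_mul_of_nonneg_left (by linarith [hM τ hτ]) hLb.le
      _ = (t' - t) * Lb * (1 + 2 * M) := by
          rw [intervalIntegral.integral_const, smul_eq_mul, mul_assoc]
  have hDle : ∀ σ ∈ Icc t' T, D σ ≤ (t' - t) * Lb * (1 + 2 * M) * Real.exp (2 * L * (σ - t')) := by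
    refine hDcont.le_mul_exp_of_le_add_integral (by positivity) fun σ hσ => ?_
    have hσs : Icc t' σ ⊆ Icc t' T := Icc_subset_Icc le_rfl hσ.2
    have hucσ := hucont.mono (prod_mono hσs (le_refl univ))
    have hubσ : ∀ τ ∈ Icc t' σ, ∀ y, ‖u τ y‖ ≤ G' y + G y := fun τ hτ => hubound τ (hσs hτ)
    have j1 : Integrable (fun y => ∫ τ in t..t', Lb * (1 + ‖X τ y‖ + M)) m :=
      hXn.integrable_intervalIntegral (f := fun τ y => Lb * (1 + ‖X τ y‖ + M)) htt' hGi hXnbound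
    have j2 : Integrable (fun y => L * ∫ τ in t'..σ, u τ y) m :=
      (hucσ.integrable_intervalIntegral hσ.1 (hG'.add hG) hubσ).const_mul L
    have j3 : Integrable (fun _ : EuclideanSpace ℝ (Fin d) => L * ∫ τ in t'..σ, D τ) m :=
      integrable_const _
    have j4 : Integrable (fun y => (L * ∫ τ in t'..σ, u τ y) + L * ∫ τ in t'..σ, D τ) m :=
      j2.add j3
    have j0 : Integrable (u σ) m :=
      (hG'.add hG).mono' (hucont.slice_right hσ).aestronglyMeasurable
        (.of_forall fun y => hubound σ hσ y)
    calc D σ ≤ ∫ y, ((∫ τ in t..t', Lb * (1 + ‖X τ y‖ + M)) +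
          ((L * ∫ τ in t'..σ, u τ y) + L * ∫ τ in t'..σ, D τ)) ∂m :=
          integral_mono j0 (j1.add j4) fun y =>
            (hmain y σ hσ).trans (add_le_add_left (hinit y) _)
      _ = (∫ y, (∫ τ in t..t', Lb * (1 + ‖X τ y‖ + M)) ∂m) + 2 * L * ∫ τ in t'..σ, D τ := by
          rw [integral_add j1 j4, integral_add j2 j3, integral_const_mul,
            hucσ.integral_intervalIntegral_swap hσ.1 (hG'.add hG) hubσ]
          simp only [integral_const, probReal_univ, one_smul, hDdef]
          ring
      _ ≤ _ := add_le_add_left hinitm _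
  intro x
  set A : ℝ := sSup ((fun τ => ‖X τ x‖) '' Icc t t')
  have hinitx : ‖∫ τ in t..t', B τ (X τ x) (m.map (X τ))‖ ≤ (t' - t) * Lb * (1 + A + M) := by
    have h := intervalIntegral.norm_integral_le_of_norm_le_const (a := t) (b := t')
      (f := fun τ => B τ (X τ x) (m.map (X τ))) (C := Lb * (1 + A + M)) fun τ hτ => by
        rw [uIoc_of_le htt'] at hτ
        have hτ' := Ioc_subset_Icc_self hτ
        refine (hgrow x τ hτ').trans ?_
        gcongr
        exact hA x τ hτ'
    rw [abs_of_nonneg (sub_nonneg.2 htt')] at h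
    linarith
  set c : ℝ := (t' - t) * Lb * (1 + A + M +
    L * (s - t') * (1 + 2 * M) * Real.exp (2 * L * (s - t'))) with hc
  have hδ : 0 ≤ t' - t := sub_nonneg.2 htt'
  have hss : Icc t' s ⊆ Icc t' T := Icc_subset_Icc le_rfl hsT
  have hfin := ContinuousOn.le_mul_exp_of_le_add_integral (c := c) hL.le
    ((hucont.slice_left x).mono hss) (fun σ hσ => by
      have hDint : ∫ τ in t'..σ, D τ ≤
          (s - t') * ((t' - t) * Lb * (1 + 2 * M) * Real.exp (2 * L * (s - t'))) := by
        have hσs : Icc t' σ ⊆ Icc t' T := Icc_subset_Icc le_rfl (hσ.2.trans hsT)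
        calc _ ≤ ∫ τ in t'..σ, (t' - t) * Lb * (1 + 2 * M) * Real.exp (2 * L * (s - t')) := by
              refine intervalIntegral.integral_mono_on hσ.1
                ((hDcont.mono hσs).intervalIntegrable_of_Icc hσ.1) intervalIntegrable_const
                fun τ hτ => (hDle τ (hσs hτ)).trans ?_
              gcongr
              exact hτ.2.trans hσ.2
          _ ≤ _ := by
              rw [intervalIntegral.integral_const, smul_eq_mul]
              gcongr
              exact hσ.2
      have h1 := hmain x σ (hss hσ)
      have h2 := mul_le_mul_of_nonneg_left hDint hL.le
      rw [hc]
      linarith) s ⟨ht's, le_rfl⟩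
  calc ‖X' s x - X s x‖ ≤ c * Real.exp (L * (s - t')) := hfin
    _ = _ := by rw [hc]; ring
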